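/- arXiv:1407.4548 — 8 statements merged into one kernel-verified Lean document; each statement's English description precedes it below -/
import Mathlib

section
/- Let p₁, q₁, p₂, q₂ be unit quaternions, and consider the two great 3-spheres Σ₁ = {(x, p₁ x q₁⁻¹) : x a unit quaternion} and Σ₂ = {(x, p₂ x q₂⁻¹) : x a unit quaternion} in the Clifford torus S³ × S³. Then Σ₁ and Σ₂ are disjoint if and only if ‖p₁ − p₂‖ ≠ ‖q₁ − q₂‖ (equivalently, there exists a unit quaternion x with p₁ x q₁⁻¹ = p₂ x q₂⁻¹ if and only if re(p₂⁻¹ * p₁) = re(q₂⁻¹ * q₁)). -/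
open Quaternion

lemma gs_normSq {a : ℍ[ℝ]} (h : ‖a‖ = 1) : a.re^2 + a.imI^2 + a.imJ^2 + a.imK^2 = 1 := by
  have := Quaternion.normSq_eq_norm_mul_self a
  rw [Quaternion.normSq_def', h] at this
  linarith

lemma gs_inv {a : ℍ[ℝ]} (h : ‖a‖ = 1) : a⁻¹ = star a := by
  rw [Quaternion.inv_def, Quaternion.normSq_eq_norm_mul_self, h]; simp

lemma gs_mk (r i j k : ℝ) : ∃ x : ℍ[ℝ], x.re = r ∧ x.imI = i ∧ x.imJ = j ∧ x.imK = k :=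
  ⟨⟨r, i, j, k⟩, rfl, rfl, rfl, rfl⟩

lemma gs_exists (a b : ℍ[ℝ]) (ha : ‖a‖ = 1) (hb : ‖b‖ = 1) (h : a.re = b.re) :
    ∃ x : ℍ[ℝ], x ≠ 0 ∧ a * x = x * b := by
  have h1 := gs_normSq ha
  have h2 := gs_normSq hb
  by_cases hab : a = star b
  · by_cases h0 : a.imI = 0 ∧ a.imJ = 0
    · obtain ⟨x, e1, e2, e3, e4⟩ := gs_mk 0 1 0 0
      refine ⟨x, fun h => by simp [h] at e2, ?_⟩
      obtain rfl : b = star a := by rw [hab, star_star]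
      apply Quaternion.ext <;> simp [h0.1, h0.2, e1, e2, e3, e4]
    · obtain ⟨x, e1, e2, e3, e4⟩ := gs_mk 0 a.imJ (-a.imI) 0
      refine ⟨x, fun h => h0 ⟨?_, ?_⟩, ?_⟩
      · simpa [h] using e3.symm
      · simpa [h] using e2.symm
      obtain rfl : b = star a := by rw [hab, star_star]
      apply Quaternion.ext <;> simp [e1, e2, e3, e4] <;> ring
  · refine ⟨a - star b, sub_ne_zero.2 hab, ?_⟩
    rw [h] at h1
    ext <;> simp [h]
    · linear_combination h2 - h1
    all_goals ring

lemma gs_re (a b x : ℍ[ℝ]) (hx : ‖x‖ = 1) (h : a * x = x * b) : a.re = b.re := by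
  have h1 := gs_normSq hx
  have h2 := congrArg (fun y => (star x * y).re) h
  simp at h2
  linear_combination h2 - (a.re - b.re) * h1

lemma gs_norm (p q : ℍ[ℝ]) (hp : ‖p‖ = 1) (hq : ‖q‖ = 1) :
    ‖p - q‖^2 = 2 - 2 * (q⁻¹ * p).re := by
  have h1 := gs_normSq hp
  have h2 := gs_normSq hq
  rw [gs_inv hq, sq, ← Quaternion.normSq_eq_norm_mul_self, Quaternion.normSq_def']
  simp
  linear_combination h1 + h2

/-- Two great 3-spheres Σ₁ = {(x, p₁ x q₁⁻¹)} and Σ₂ = {(x, p₂ x q₂⁻¹)} in the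
Clifford torus S³ × S³ are disjoint iff ‖p₁ − p₂‖ ≠ ‖q₁ − q₂‖; equivalently, they intersect
iff re(p₂⁻¹ p₁) = re(q₂⁻¹ q₁). -/
theorem great_spheres_disjoint_iff (p₁ q₁ p₂ q₂ : ℍ[ℝ])
    (hp₁ : ‖p₁‖ = 1) (hq₁ : ‖q₁‖ = 1) (hp₂ : ‖p₂‖ = 1) (hq₂ : ‖q₂‖ = 1) :
    ((∀ x : ℍ[ℝ], ‖x‖ = 1 → p₁ * x * q₁⁻¹ ≠ p₂ * x * q₂⁻¹) ↔ ‖p₁ - p₂‖ ≠ ‖q₁ - q₂‖) ∧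
    ((∃ x : ℍ[ℝ], ‖x‖ = 1 ∧ p₁ * x * q₁⁻¹ = p₂ * x * q₂⁻¹) ↔
      (p₂⁻¹ * p₁).re = (q₂⁻¹ * q₁).re) := by
  have n1 : q₁ ≠ 0 := by rintro rfl; simp at hq₁
  have n2 : p₂ ≠ 0 := by rintro rfl; simp at hp₂
  have key : ∀ x : ℍ[ℝ], p₁ * x * q₁⁻¹ = p₂ * x * q₂⁻¹ ↔
      (p₂⁻¹ * p₁) * x = x * (q₂⁻¹ * q₁) := by
    intro x
    rw [mul_inv_eq_iff_eq_mul₀ n1, mul_assoc p₂⁻¹, inv_mul_eq_iff_eq_mul₀ n2]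
    simp only [mul_assoc]
  have B : (∃ x : ℍ[ℝ], ‖x‖ = 1 ∧ p₁ * x * q₁⁻¹ = p₂ * x * q₂⁻¹) ↔
      (p₂⁻¹ * p₁).re = (q₂⁻¹ * q₁).re := by
    simp only [key]
    constructor
    · rintro ⟨x, hx, h⟩
      exact gs_re _ _ x hx h
    · intro h
      obtain ⟨x, hx, hh⟩ := gs_exists _ _ (by simp [hp₁, hp₂]) (by simp [hq₁, hq₂]) h
      refine ⟨(‖x‖⁻¹ : ℝ) • x, ?_, ?_⟩
      · rw [norm_smul, norm_inv, norm_norm, inv_mul_cancel₀ (norm_ne_zero_iff.2 hx)]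
      · rw [mul_smul_comm, smul_mul_assoc, hh]
  refine ⟨?_, B⟩
  have C : ‖p₁ - p₂‖ = ‖q₁ - q₂‖ ↔ (p₂⁻¹ * p₁).re = (q₂⁻¹ * q₁).re := by
    rw [← sq_eq_sq₀ (norm_nonneg _) (norm_nonneg _), gs_norm _ _ hp₁ hp₂, gs_norm _ _ hq₁ hq₂]
    constructor <;> intro h <;> linarith
  rw [Ne, C, ← B]
  push Not
  rfl
end

section
/- Two unit quaternions a and b are conjugate by a unit quaternion (i.e., there exists a unit quaternion z with z⁻¹ * a * z = b) if and only if they have the same real part: re a = re b. -/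
open Quaternion

lemma re_mul_comm_aux (x y : ℍ[ℝ]) : (x * y).re = (y * x).re := by
  simp only [Quaternion.re_mul]; ring

lemma exists_comp_aux (p q r s : ℝ) :
    ∃ w : ℍ[ℝ], w.re = p ∧ w.imI = q ∧ w.imJ = r ∧ w.imK = s :=
  ⟨⟨p, q, r, s⟩, rfl, rfl, rfl, rfl⟩

lemma exists_intertwiner_aux (a b : ℍ[ℝ]) (h : a.re = b.re)
    (hn : a.imI ^ 2 + a.imJ ^ 2 + a.imK ^ 2 = b.imI ^ 2 + b.imJ ^ 2 + b.imK ^ 2) :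
    ∃ w : ℍ[ℝ], w ≠ 0 ∧ a * w = w * b := by
  by_cases hw : a.im + b.im = 0
  · have h1 : b.imI = -a.imI := by
      have := congrArg QuaternionAlgebra.imI hw
      simp at this; linarith
    have h2 : b.imJ = -a.imJ := by
      have := congrArg QuaternionAlgebra.imJ hw
      simp at this; linarith
    have h3 : b.imK = -a.imK := by
      have := congrArg QuaternionAlgebra.imK hw
      simp at this; linarith
    by_cases h0 : a.imI = 0 ∧ a.imJ = 0
    · obtain ⟨hx, hy⟩ := h0
      obtain ⟨w, w0, w1, w2, w3⟩ := exists_comp_aux 0 1 0 0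
      refine ⟨w, ?_, ?_⟩
      · rintro rfl
        simp at w1
      · ext <;> simp [h1, h2, h3, h, hx, hy, w0, w1, w2, w3]
    · obtain ⟨w, w0, w1, w2, w3⟩ := exists_comp_aux 0 (-a.imJ) a.imI 0
      refine ⟨w, ?_, ?_⟩
      · rintro rfl
        apply h0
        simp at w1 w2
        exact ⟨w2.symm, w1⟩
      · ext <;> simp [h1, h2, h3, h, w0, w1, w2, w3] <;> ring
  · refine ⟨a.im + b.im, hw, ?_⟩
    ext <;> simp [h] <;> linarith

/-- Two unit quaternions are conjugate by a unit quaternion iff they have the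
same real part. -/
theorem unit_quaternion_conjugate_iff_re_eq (a b : ℍ[ℝ]) (ha : ‖a‖ = 1) (hb : ‖b‖ = 1) :
    (∃ z : ℍ[ℝ], ‖z‖ = 1 ∧ z⁻¹ * a * z = b) ↔ a.re = b.re := by
  constructor
  · rintro ⟨z, hz, rfl⟩
    have hz0 : z ≠ 0 := by
      rintro rfl
      simp at hz
    rw [re_mul_comm_aux, ← mul_assoc, mul_inv_cancel₀ hz0, one_mul]
  · intro h
    have hA := normSq_eq_norm_mul_self a
    have hB := normSq_eq_norm_mul_self b
    rw [ha, normSq_def'] at hA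
    rw [hb, normSq_def'] at hB
    obtain ⟨w, hw, e⟩ := exists_intertwiner_aux a b h (by rw [h] at hA; linarith)
    have hn : ‖w‖ ≠ 0 := norm_ne_zero_iff.mpr hw
    have hz : ‖w‖⁻¹ • w ≠ 0 := smul_ne_zero (inv_ne_zero hn) hw
    refine ⟨‖w‖⁻¹ • w, ?_, ?_⟩
    · rw [norm_smul, norm_inv, norm_norm, inv_mul_cancel₀ hn]
    · rw [mul_assoc, mul_smul_comm, e, ← smul_mul_assoc, ← mul_assoc, inv_mul_cancel₀ hz, one_mul]
end

section
/- Let f : ℍ → ℍ be a continuous map taking unit quaternions to unit quaternions that is strictly distance-decreasing on the unit sphere: ‖f(p) − f(q)‖ < ‖p − q‖ for all unit quaternions p ≠ q. Then for every pair of unit quaternions (x, y) there exists a unique unit quaternion p such that y = p * x * (f p)⁻¹. (Consequently the great 3-spheres Σ_p(f) = {(x, p x (f p)⁻¹) : ‖x‖ = 1}, for p ranging over unit quaternions, partition S³ × S³.) -/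
open Quaternion

/-- If `f` is a continuous map taking unit quaternions to unit quaternions and
strictly distance-decreasing on the unit sphere, then for every pair of unit quaternions
`(x, y)` there is a unique unit quaternion `p` with `y = p * x * (f p)⁻¹`.  (Hence the great
3-spheres `Σ_p(f) = {(x, p x (f p)⁻¹)}` partition `S³ × S³`.) -/
theorem petro_fibration_exists_unique (f : ℍ[ℝ] → ℍ[ℝ]) (hf_cont : Continuous f)
    (hf_unit : ∀ p : ℍ[ℝ], ‖p‖ = 1 → ‖f p‖ = 1)
    (hf_contract : ∀ p q : ℍ[ℝ], ‖p‖ = 1 → ‖q‖ = 1 → p ≠ q → ‖f p - f q‖ < ‖p - q‖)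
    (x y : ℍ[ℝ]) (hx : ‖x‖ = 1) (hy : ‖y‖ = 1) :
    ∃! p : ℍ[ℝ], ‖p‖ = 1 ∧ y = p * x * (f p)⁻¹ := by
  have hx0 : x ≠ 0 := by rintro rfl; simp at hx
  have key : ∀ p : ℍ[ℝ], ‖p‖ = 1 → (y = p * x * (f p)⁻¹ ↔ p = y * f p * x⁻¹) := by
    intro p hp
    have hfp : f p ≠ 0 := by
      intro h
      have := hf_unit p hp
      simp [h] at this
    rw [eq_mul_inv_iff_mul_eq₀ hfp, eq_mul_inv_iff_mul_eq₀ hx0, eq_comm]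
  have hg1 : ∀ p : ℍ[ℝ], ‖p‖ = 1 → ‖y * f p * x⁻¹‖ = 1 := by
    intro p hp
    rw [norm_mul, norm_mul, norm_inv, hx, hy, hf_unit p hp]; norm_num
  have hgc : ∀ p q : ℍ[ℝ], ‖p‖ = 1 → ‖q‖ = 1 → p ≠ q →
      ‖y * f p * x⁻¹ - y * f q * x⁻¹‖ < ‖p - q‖ := by
    intro p q hp hq h
    rw [← sub_mul, ← mul_sub, norm_mul, norm_mul, norm_inv, hx, hy]
    simpa using hf_contract p q hp hq h
  have hcont : Continuous fun p : ℍ[ℝ] => ‖p - y * f p * x⁻¹‖ :=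
    (continuous_id.sub ((continuous_const.mul hf_cont).mul continuous_const)).norm
  haveI : ProperSpace ℍ[ℝ] := FiniteDimensional.proper ℝ _
  obtain ⟨p, hp, hmin⟩ := (isCompact_sphere (0 : ℍ[ℝ]) 1).exists_isMinOn
    ⟨1, by simp⟩ hcont.continuousOn
  have hp1 : ‖p‖ = 1 := by simpa using hp
  refine ⟨p, ⟨hp1, (key p hp1).2 ?_⟩, ?_⟩
  · by_contra hne
    have h1 := hgc _ _ hp1 (hg1 p hp1) hne
    have h2 := isMinOn_iff.1 hmin (y * f p * x⁻¹) (by simpa using hg1 p hp1)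
    exact absurd h1 (not_lt.2 h2)
  · rintro q ⟨hq1, hq⟩
    have hq' := (key q hq1).1 hq
    have hp' : p = y * f p * x⁻¹ := by
      by_contra hne
      have h1 := hgc _ _ hp1 (hg1 p hp1) hne
      have h2 := isMinOn_iff.1 hmin (y * f p * x⁻¹) (by simpa using hg1 p hp1)
      exact absurd h1 (not_lt.2 h2)
    by_contra hne
    have h := hgc q p hq1 hp1 hne
    rw [← hq', ← hp'] at h
    exact lt_irrefl _ h
end

section
/- Fix α with 0 < α ≤ π/6 and let f_α(p) := p * (cos α + i sin α) * p⁻¹. Then f_α is strictly distance-decreasing on unit quaternions: for all unit quaternions p ≠ q, ‖f_α(p) − f_α(q)‖ < ‖p − q‖. -/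
open Quaternion

/-- The first quaternion imaginary unit `i`. -/
noncomputable def qi : ℍ[ℝ] := ⟨0, 1, 0, 0⟩

/-- `e^{iα} = cos α + i sin α` as a quaternion. -/
noncomputable def eI (α : ℝ) : ℍ[ℝ] := (Real.cos α : ℍ[ℝ]) + (Real.sin α : ℍ[ℝ]) * qi

/-- `f_α(p) = p e^{iα} p⁻¹`. -/
noncomputable def fAlpha (α : ℝ) (p : ℍ[ℝ]) : ℍ[ℝ] := p * eI α * p⁻¹

/-- For `0 < α ≤ π/6`, the map `f_α(p) = p (cos α + i sin α) p⁻¹` is strictly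
distance-decreasing on unit quaternions. -/
theorem fAlpha_strictly_distance_decreasing (α : ℝ) (hα : 0 < α) (hα' : α ≤ Real.pi / 6)
    (p q : ℍ[ℝ]) (hp : ‖p‖ = 1) (hq : ‖q‖ = 1) (hpq : p ≠ q) :
    ‖fAlpha α p - fAlpha α q‖ < ‖p - q‖ := by
  have hp0 : p ≠ 0 := by
    rintro rfl
    simp at hp
  have hq0 : q ≠ 0 := by
    rintro rfl
    simp at hq
  obtain ⟨u, hu⟩ : ∃ u, u = q⁻¹ * p := ⟨_, rfl⟩
  have hun : ‖u‖ = 1 := by rw [hu, norm_mul, norm_inv, hp, hq]; norm_num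
  have hu1 : u ≠ 1 := by
    intro h
    apply hpq
    rw [h] at hu
    have : q * 1 = q * (q⁻¹ * p) := by rw [← hu]
    rw [mul_inv_cancel_left₀ hq0, mul_one] at this
    exact this.symm
  have h1 : ‖p - q‖ = ‖u - 1‖ := by
    have : u - 1 = q⁻¹ * (p - q) := by rw [mul_sub, inv_mul_cancel₀ hq0, hu]
    rw [this, norm_mul, norm_inv, hq]; simp
  have h2 : ‖fAlpha α p - fAlpha α q‖ = ‖u * eI α - eI α * u‖ := by
    have : u * eI α - eI α * u = q⁻¹ * (fAlpha α p - fAlpha α q) * p := by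
      rw [hu, fAlpha, fAlpha, mul_sub, sub_mul]
      congr 1
      · simp only [mul_assoc, inv_mul_cancel₀ hp0, mul_one]
      · simp only [mul_assoc, inv_mul_cancel_left₀ hq0]
    rw [this, norm_mul, norm_mul, norm_inv, hq, hp]; simp
  rw [h1, h2]
  have hs0 : 0 < Real.sin α := Real.sin_pos_of_pos_of_lt_pi hα (by linarith [Real.pi_pos])
  have hs : Real.sin α ≤ 1 / 2 := by
    rw [← Real.sin_pi_div_six]
    exact Real.sin_le_sin_of_le_of_le_pi_div_two (by linarith [Real.pi_pos])
      (by linarith [Real.pi_pos]) hα'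
  apply lt_of_pow_lt_pow_left₀ 2 (norm_nonneg _)
  have hn : ‖u‖ ^ 2 = 1 := by rw [hun]; norm_num
  rw [sq, ← Quaternion.normSq_eq_norm_mul_self, Quaternion.normSq_def'] at hn
  rw [sq, sq, ← Quaternion.normSq_eq_norm_mul_self, ← Quaternion.normSq_eq_norm_mul_self,
    Quaternion.normSq_def', Quaternion.normSq_def']
  have hu1' : ¬ (u.re = 1 ∧ u.imI = 0 ∧ u.imJ = 0 ∧ u.imK = 0) := by
    rintro ⟨e1, e2, e3, e4⟩
    exact hu1 (by ext <;> simp [e1, e2, e3, e4])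
  have eR : (eI α).re = Real.cos α := by
    simp only [eI, Quaternion.re_add, Quaternion.re_mul]; simp [qi]
  have eX : (eI α).imI = Real.sin α := by
    simp only [eI, Quaternion.imI_add, Quaternion.imI_mul]; simp [qi]
  have eY : (eI α).imJ = 0 := by
    simp only [eI, Quaternion.imJ_add, Quaternion.imJ_mul]; simp [qi]
  have eZ : (eI α).imK = 0 := by
    simp only [eI, Quaternion.imK_add, Quaternion.imK_mul]; simp [qi]
  simp only [Quaternion.re_sub, Quaternion.imI_sub, Quaternion.imJ_sub, Quaternion.imK_sub,
    Quaternion.re_mul, Quaternion.imI_mul, Quaternion.imJ_mul, Quaternion.imK_mul, eR, eX, eY, eZ,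
    Quaternion.re_one, Quaternion.imI_one, Quaternion.imJ_one, Quaternion.imK_one]
  clear hu hun hu1 h1 h2
  generalize u.re = a at *
  generalize u.imI = b at *
  generalize u.imJ = c at *
  generalize u.imK = d at *
  have hab : 0 < (a - 1) ^ 2 + b ^ 2 := by
    by_contra h
    have ha : a = 1 := by nlinarith [sq_nonneg (a - 1), sq_nonneg b]
    have hb : b = 0 := by nlinarith [sq_nonneg (a - 1), sq_nonneg b]
    subst ha hb
    have hc : c = 0 := by nlinarith [sq_nonneg c, sq_nonneg d]
    have hd : d = 0 := by nlinarith [sq_nonneg c, sq_nonneg d]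
    subst hc hd
    exact hu1' ⟨rfl, rfl, rfl, rfl⟩
  have hss : Real.sin α ^ 2 ≤ 1 / 4 := by nlinarith
  have key : 4 * Real.sin α ^ 2 * (c ^ 2 + d ^ 2) < (a - 1) ^ 2 + b ^ 2 + c ^ 2 + d ^ 2 := by
    nlinarith [mul_le_mul_of_nonneg_right hss (by positivity : 0 ≤ c ^ 2 + d ^ 2)]
  nlinarith [key]
end

section
/- Let f be a map taking unit quaternions to unit quaternions, and let p₁, q₁, p₂, q₂ be unit quaternions such that f(p₁ * p * q₁⁻¹) = p₂ * f(p) * q₂⁻¹ for every unit quaternion p (i.e., f intertwines the isometries T₁(x) = p₁ x q₁⁻¹ and T₂(x) = p₂ x q₂⁻¹ of S³). Then for every unit quaternion p, the isometry Φ of S³ × S³ defined by Φ(x, y) = (q₁ x q₂⁻¹, p₁ y p₂⁻¹) maps the fiber Σ_p(f) bijectively onto the fiber Σ_{p₁ p q₁⁻¹}(f). In particular Φ takes fibers to fibers. -/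
open Quaternion

/-- The fiber `Σ_p(f) = {(x, p x (f p)⁻¹) : x a unit quaternion}` in `ℍ × ℍ`. -/
def SigmaFiber (f : ℍ[ℝ] → ℍ[ℝ]) (p : ℍ[ℝ]) : Set (ℍ[ℝ] × ℍ[ℝ]) :=
  {z | ∃ x : ℍ[ℝ], ‖x‖ = 1 ∧ z = (x, p * x * (f p)⁻¹)}

/-- If `f` intertwines the isometries `T₁(x) = p₁ x q₁⁻¹` and
`T₂(x) = p₂ x q₂⁻¹` of `S³`, then the isometry `Φ(x, y) = (q₁ x q₂⁻¹, p₁ y p₂⁻¹)` of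
`S³ × S³` maps each fiber `Σ_p(f)` bijectively onto the fiber `Σ_{p₁ p q₁⁻¹}(f)`. -/
theorem intertwine_maps_fibers_to_fibers (f : ℍ[ℝ] → ℍ[ℝ])
    (hf_unit : ∀ p : ℍ[ℝ], ‖p‖ = 1 → ‖f p‖ = 1)
    (p₁ q₁ p₂ q₂ : ℍ[ℝ]) (hp₁ : ‖p₁‖ = 1) (hq₁ : ‖q₁‖ = 1) (hp₂ : ‖p₂‖ = 1) (hq₂ : ‖q₂‖ = 1)
    (hf : ∀ p : ℍ[ℝ], ‖p‖ = 1 → f (p₁ * p * q₁⁻¹) = p₂ * f p * q₂⁻¹)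
    (p : ℍ[ℝ]) (hp : ‖p‖ = 1) :
    Set.BijOn (fun z : ℍ[ℝ] × ℍ[ℝ] => (q₁ * z.1 * q₂⁻¹, p₁ * z.2 * p₂⁻¹))
      (SigmaFiber f p) (SigmaFiber f (p₁ * p * q₁⁻¹)) := by
  have ne : ∀ a : ℍ[ℝ], ‖a‖ = 1 → a ≠ 0 := by
    rintro a h rfl
    simp at h
  have h1 := ne _ hq₁
  have h2 := ne _ hq₂
  have h3 := ne _ hp₁
  have h4 := ne _ hp₂
  have key : ∀ x : ℍ[ℝ], p₁ * p * q₁⁻¹ * (q₁ * x * q₂⁻¹) * (p₂ * f p * q₂⁻¹)⁻¹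
      = p₁ * (p * x * (f p)⁻¹) * p₂⁻¹ := by
    intro x
    simp only [mul_inv_rev, inv_inv, mul_assoc]
    rw [inv_mul_cancel_left₀ h1, inv_mul_cancel_left₀ h2]
  refine ⟨?_, ?_, ?_⟩
  · rintro z ⟨x, hx, rfl⟩
    refine ⟨q₁ * x * q₂⁻¹, by simp [norm_mul, norm_inv, hx, hq₁, hq₂], ?_⟩
    rw [hf p hp, key]
  · rintro ⟨a, b⟩ - ⟨c, d⟩ - h
    simpa [h1, h2, h3, h4] using h
  · rintro z ⟨x, hx, rfl⟩
    have hy : q₁ * (q₁⁻¹ * x * q₂) * q₂⁻¹ = x := by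
      simp only [mul_assoc]
      rw [mul_inv_cancel_left₀ h1, mul_inv_cancel₀ h2, mul_one]
    refine ⟨(q₁⁻¹ * x * q₂, p * (q₁⁻¹ * x * q₂) * (f p)⁻¹),
      ⟨_, by simp [norm_mul, norm_inv, hx, hq₁, hq₂], rfl⟩, ?_⟩
    have k := key (q₁⁻¹ * x * q₂)
    rw [hy] at k
    simp only [hf p hp]
    rw [k, hy]
end

section
/- For unit quaternions a and b, the infimum over unit quaternions y of dS(a, y)² + dS(b, y)² equals dS(a, b)² / 2, and this infimum is attained (at a geodesic midpoint of a and b). -/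
open Quaternion

/-- Geodesic distance on the unit 3-sphere of quaternions: `dS(a,b) = arccos ⟪a, b⟫` where
`⟪a, b⟫ = re(a * star b)`. -/
noncomputable def dS (a b : ℍ[ℝ]) : ℝ := Real.arccos (a * star b).re

theorem exists_imag_unit : ∃ i : ℍ[ℝ], ‖i‖ = 1 ∧ i.re = 0 ∧ i.imI = 1 ∧ i.imJ = 0 ∧ i.imK = 0 := by
  obtain ⟨i, h⟩ : ∃ i : ℍ[ℝ], i.re = 0 ∧ i.imI = 1 ∧ i.imJ = 0 ∧ i.imK = 0 :=
    ⟨(⟨0, 1, 0, 0⟩ : QuaternionAlgebra ℝ (-1) 0 (-1)), rfl, rfl, rfl, rfl⟩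
  refine ⟨i, ?_, h⟩
  obtain ⟨h1, h2, h3, h4⟩ := h
  have : ‖i‖ * ‖i‖ = 1 := by
    rw [← Quaternion.normSq_eq_norm_mul_self, Quaternion.normSq_def', h1, h2, h3, h4]; norm_num
  nlinarith [norm_nonneg i]

theorem dS_eq_angle (a b : ℍ[ℝ]) (ha : ‖a‖ = 1) (hb : ‖b‖ = 1) :
    dS a b = InnerProductGeometry.angle a b := by
  unfold dS InnerProductGeometry.angle
  rw [ha, hb, Quaternion.inner_def]; simp

theorem exists_mid (a b : ℍ[ℝ]) (ha : ‖a‖ = 1) (hb : ‖b‖ = 1) :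
    ∃ y : ℍ[ℝ], ‖y‖ = 1 ∧ dS a y = dS a b / 2 ∧ dS b y = dS a b / 2 := by
  have haa : inner ℝ a a = (1:ℝ) := by rw [real_inner_self_eq_norm_sq, ha]; norm_num
  have hbb : inner ℝ b b = (1:ℝ) := by rw [real_inner_self_eq_norm_sq, hb]; norm_num
  by_cases h : a + b = 0
  · obtain rfl : b = -a := (neg_eq_of_add_eq_zero_right h).symm
    have h1 : (a * star a).re = 1 := by rw [← Quaternion.inner_def]; exact haa
    obtain ⟨i, hi, i1, i2, i3, i4⟩ := exists_imag_unit
    have h0 : (a * star (a * i)).re = 0 := by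
      simp [i1, i2, i3, i4]; ring
    refine ⟨a * i, by rw [norm_mul, ha, hi]; norm_num, ?_, ?_⟩
    · unfold dS
      rw [h0, star_neg, mul_neg, Quaternion.re_neg, h1]; simp
    · unfold dS
      rw [neg_mul, Quaternion.re_neg, h0, star_neg, mul_neg, Quaternion.re_neg, h1]; simp
  · have hn : 0 < ‖a + b‖ := norm_pos_iff.2 h
    set c : ℝ := inner ℝ a b with hc
    have hsq : ‖a + b‖ ^ 2 = 2 * (1 + c) := by
      rw [norm_add_sq_real, ha, hb]; ring
    have hc1 : |c| ≤ 1 := by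
      have := abs_real_inner_le_norm a b
      rwa [ha, hb, one_mul] at this
    have hc2 := abs_le.1 hc1
    have hd : dS a b = Real.arccos c := by rw [hc, Quaternion.inner_def]; rfl
    have hcos : Real.cos (dS a b / 2) = ‖a + b‖⁻¹ * (1 + c) := by
      rw [hd, Real.cos_half (by linarith [Real.arccos_nonneg c, Real.pi_pos])
        (Real.arccos_le_pi c), Real.cos_arccos hc2.1 hc2.2]
      have : (1 + c) / 2 = (‖a + b‖ / 2) ^ 2 := by linarith
      rw [this, Real.sqrt_sq (by positivity)]
      field_simp; linarith
    have hfin : Real.arccos (‖a + b‖⁻¹ * (1 + c)) = dS a b / 2 := by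
      rw [← hcos, Real.arccos_cos] <;> rw [hd] <;>
        linarith [Real.arccos_nonneg c, Real.arccos_le_pi c]
    refine ⟨‖a + b‖⁻¹ • (a + b), ?_, ?_, ?_⟩
    · rw [norm_smul, norm_inv, norm_norm]; field_simp
    · rw [← hfin]; unfold dS
      rw [← Quaternion.inner_def, real_inner_smul_right, inner_add_right, haa]
    · rw [← hfin]; unfold dS
      rw [← Quaternion.inner_def, real_inner_smul_right, inner_add_right, hbb,
        real_inner_comm, ← hc, add_comm c]

/-- For unit quaternions `a, b`, the infimum over unit quaternions `y` of
`dS(a,y)² + dS(b,y)²` equals `dS(a,b)²/2`, and the infimum is attained. -/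
theorem inf_sum_sq_dist_to_midpoint (a b : ℍ[ℝ]) (ha : ‖a‖ = 1) (hb : ‖b‖ = 1) :
    sInf {v : ℝ | ∃ y : ℍ[ℝ], ‖y‖ = 1 ∧ v = dS a y ^ 2 + dS b y ^ 2} = dS a b ^ 2 / 2 ∧
    ∃ y : ℍ[ℝ], ‖y‖ = 1 ∧ dS a y ^ 2 + dS b y ^ 2 = dS a b ^ 2 / 2 := by
  obtain ⟨y, hy, h1, h2⟩ := exists_mid a b ha hb
  have hy' : dS a y ^ 2 + dS b y ^ 2 = dS a b ^ 2 / 2 := by rw [h1, h2]; ring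
  refine ⟨IsLeast.csInf_eq ⟨⟨y, hy, hy'.symm⟩, ?_⟩, y, hy, hy'⟩
  rintro v ⟨z, hz, rfl⟩
  have ht : dS a b ≤ dS a z + dS b z := by
    rw [dS_eq_angle a b ha hb, dS_eq_angle a z ha hz, dS_eq_angle b z hb hz,
      InnerProductGeometry.angle_comm b z]
    exact InnerProductGeometry.angle_le_angle_add_angle a z b
  have h0 : 0 ≤ dS a b := Real.arccos_nonneg _
  nlinarith [sq_nonneg (dS a z - dS b z)]
end

section
/- Let u be a purely imaginary unit quaternion (re u = 0, ‖u‖ = 1) and let 0 < φ < θ < π; write e^{uθ} := cos θ + u sin θ. Then for every unit quaternion z: (1) dS(z, e^{−uθ} z e^{uφ}) ≥ θ − φ, with equality if and only if z = cos t + u sin t for some t ∈ ℝ; and (2) dS(z, e^{−uθ} z e^{uφ}) ≤ Real.arccos(cos θ cos φ − sin θ sin φ), with equality if and only if z is a purely imaginary unit quaternion orthogonal to u (re z = 0 and ⟪z, u⟫ = 0). -/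
open Quaternion

/-- `e^{ut} = cos t + u sin t` for a purely imaginary unit quaternion `u`. -/
noncomputable def eU (u : ℍ[ℝ]) (t : ℝ) : ℍ[ℝ] := (Real.cos t : ℍ[ℝ]) + (Real.sin t : ℍ[ℝ]) * u

set_option maxHeartbeats 1000000 in
/-- For a purely imaginary unit quaternion `u` and `0 < φ < θ < π`, for every
unit quaternion `z`: (1) `dS(z, e^{−uθ} z e^{uφ}) ≥ θ − φ`, with equality iff
`z = cos t + u sin t` for some `t`; and (2) `dS(z, e^{−uθ} z e^{uφ}) ≤
arccos(cos θ cos φ − sin θ sin φ)`, with equality iff `z` is a purely imaginary unit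
quaternion orthogonal to `u`. -/
theorem hot_cold_general_axis (u : ℍ[ℝ]) (hu_im : u.re = 0) (hu : ‖u‖ = 1)
    (θ φ : ℝ) (hφ : 0 < φ) (hφθ : φ < θ) (hθ : θ < Real.pi)
    (z : ℍ[ℝ]) (hz : ‖z‖ = 1) :
    (θ - φ ≤ dS z (eU u (-θ) * z * eU u φ) ∧
      (dS z (eU u (-θ) * z * eU u φ) = θ - φ ↔ ∃ t : ℝ, z = eU u t)) ∧
    (dS z (eU u (-θ) * z * eU u φ) ≤
        Real.arccos (Real.cos θ * Real.cos φ - Real.sin θ * Real.sin φ) ∧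
      (dS z (eU u (-θ) * z * eU u φ) =
          Real.arccos (Real.cos θ * Real.cos φ - Real.sin θ * Real.sin φ) ↔
        z.re = 0 ∧ (z * star u).re = 0)) := by
  have hu2 : u.imI^2+u.imJ^2+u.imK^2 = 1 := by
    have h := Quaternion.normSq_eq_norm_mul_self u
    rw [hu, Quaternion.normSq_def', hu_im] at h
    linarith
  have hz2 : z.re^2+z.imI^2+z.imJ^2+z.imK^2 = 1 := by
    have h := Quaternion.normSq_eq_norm_mul_self z
    rw [hz, Quaternion.normSq_def'] at h
    linarith
  obtain ⟨s, hs⟩ : ∃ s, s = u.imI*z.imI+u.imJ*z.imJ+u.imK*z.imK := ⟨_, rfl⟩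
  have hzu : (z * star u).re = s := by
    simp [Quaternion.re_mul, hu_im, hs]; ring
  have hin : (z * star (eU u (-θ) * z * eU u φ)).re
      = Real.cos θ * Real.cos φ + Real.sin θ * Real.sin φ * (2*(z.re^2+s^2)-1) := by
    simp only [eU, Real.cos_neg, Real.sin_neg]
    simp [Quaternion.re_mul, Quaternion.imI_mul, Quaternion.imJ_mul, Quaternion.imK_mul, hu_im]
    rw [hs]
    generalize Real.cos θ = a
    generalize Real.cos φ = b
    generalize Real.sin θ = c
    generalize Real.sin φ = d
    linear_combination (a*b - c*d) * hz2 + c*d*(z.re^2-z.imI^2-z.imJ^2-z.imK^2) * hu2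
  have hlag : 1 - (z.re^2+s^2) = (u.imI*z.imJ-u.imJ*z.imI)^2+(u.imI*z.imK-u.imK*z.imI)^2
      +(u.imJ*z.imK-u.imK*z.imJ)^2 := by
    rw [hs]
    linear_combination (-1) * hz2 - (z.imI^2+z.imJ^2+z.imK^2) * hu2
  have hsθ : 0 < Real.sin θ := Real.sin_pos_of_pos_of_lt_pi (by linarith) hθ
  have hsφ : 0 < Real.sin φ := Real.sin_pos_of_pos_of_lt_pi hφ (by linarith)
  have hpos : 0 < Real.sin θ * Real.sin φ := mul_pos hsθ hsφ
  have hP0 : 0 ≤ z.re^2+s^2 := by positivity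
  have hP1 : z.re^2+s^2 ≤ 1 := by
    have : 0 ≤ 1 - (z.re^2+s^2) := by rw [hlag]; positivity
    linarith
  have hac : θ - φ = Real.arccos (Real.cos θ * Real.cos φ + Real.sin θ * Real.sin φ) := by
    rw [← Real.cos_sub, Real.arccos_cos (by linarith) (by linarith)]
  have hA := Real.cos_le_one (θ - φ)
  have hB := Real.neg_one_le_cos (θ + φ)
  rw [Real.cos_sub] at hA
  rw [Real.cos_add] at hB
  have hI1 : Real.cos θ * Real.cos φ + Real.sin θ * Real.sin φ * (2*(z.re^2+s^2)-1)
      ≤ Real.cos θ * Real.cos φ + Real.sin θ * Real.sin φ := by nlinarith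
  have hI2 : Real.cos θ * Real.cos φ - Real.sin θ * Real.sin φ ≤
      Real.cos θ * Real.cos φ + Real.sin θ * Real.sin φ * (2*(z.re^2+s^2)-1) := by nlinarith
  unfold dS
  rw [hin, hzu, hac]
  refine ⟨⟨Real.arccos_le_arccos hI1, ?_⟩, Real.arccos_le_arccos hI2, ?_⟩
  · rw [Real.arccos_inj (by linarith) (by linarith) (by linarith) (by linarith)]
    constructor
    · intro h
      have hP : z.re^2+s^2 = 1 := by
        have : Real.sin θ * Real.sin φ * (z.re^2+s^2 - 1) = 0 := by linarith
        rcases mul_eq_zero.1 this with h | h <;> linarith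
      rw [hP] at hlag
      have key : ∀ a b c : ℝ, (1:ℝ) - 1 = a^2+b^2+c^2 → a = 0 ∧ b = 0 ∧ c = 0 := by
        intro a b c h
        refine ⟨?_, ?_, ?_⟩ <;> apply (pow_eq_zero_iff two_ne_zero).1 <;>
          linarith [sq_nonneg a, sq_nonneg b, sq_nonneg c]
      obtain ⟨h1, h2, h3⟩ := key _ _ _ hlag
      have hn : ‖(⟨z.re, s⟩ : ℂ)‖ = 1 := by
        rw [← sq_eq_sq₀ (norm_nonneg _) zero_le_one, Complex.sq_norm, Complex.normSq_mk]
        linarith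
      have hc := Complex.norm_mul_cos_arg (⟨z.re, s⟩ : ℂ)
      have hd := Complex.norm_mul_sin_arg (⟨z.re, s⟩ : ℂ)
      rw [hn, one_mul] at hc hd
      refine ⟨Complex.arg ⟨z.re, s⟩, ?_⟩
      unfold eU
      rw [hc, hd]
      ext
      · simp [hu_im]
      · simp [hs]
        linear_combination (-z.imI) * hu2 - u.imJ * h1 - u.imK * h2
      · simp [hs]
        linear_combination (-z.imJ) * hu2 + u.imI * h1 - u.imK * h3
      · simp [hs]
        linear_combination (-z.imK) * hu2 + u.imI * h2 + u.imJ * h3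
    · rintro ⟨t, rfl⟩
      have e1 : (eU u t).re = Real.cos t := by simp [eU, hu_im]
      have e2 : s = Real.sin t := by
        rw [hs]; simp [eU]; linear_combination Real.sin t * hu2
      rw [e1, e2, Real.cos_sq_add_sin_sq]; ring
  · rw [Real.arccos_inj (by linarith) (by linarith) (by linarith) (by linarith)]
    constructor
    · intro h
      have hP : z.re^2+s^2 = 0 := by
        have : Real.sin θ * Real.sin φ * (z.re^2+s^2) = 0 := by linarith
        rcases mul_eq_zero.1 this with h | h <;> linarith
      constructor <;> apply (pow_eq_zero_iff two_ne_zero).1 <;>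
        linarith [sq_nonneg z.re, sq_nonneg s]
    · rintro ⟨h1, h2⟩
      rw [h1, h2]; ring
end

section
/- For all real ε, α, θ, let q' := (cos ε + j_θ sin ε)(cos α − i sin α)(cos ε − j_θ sin ε)(cos α + i sin α) where j_θ := j cos θ + k sin θ, and let β := (π/2 − α)/2. Then the conjugated quaternion q'' := (cos β − i sin β) · q' · (cos β + i sin β) satisfies q'' = (cos²ε + sin²ε cos 2α) + (sin²ε sin 2α) · i + (2 cos ε sin ε sin α) · (j cos θ + k sin θ). -/
open Quaternion

noncomputable def qj : ℍ[ℝ] := ⟨0, 0, 1, 0⟩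
noncomputable def qk : ℍ[ℝ] := ⟨0, 0, 0, 1⟩

/-- `j_θ = j cos θ + k sin θ`. -/
noncomputable def jTheta (θ : ℝ) : ℍ[ℝ] :=
  qj * (Real.cos θ : ℍ[ℝ]) + qk * (Real.sin θ : ℍ[ℝ])

/-- `q' = e^{j_θ ε} e^{−iα} e^{−j_θ ε} e^{iα}`. -/
noncomputable def qPrime (ε α θ : ℝ) : ℍ[ℝ] :=
  ((Real.cos ε : ℍ[ℝ]) + jTheta θ * (Real.sin ε : ℍ[ℝ])) *
    ((Real.cos α : ℍ[ℝ]) - qi * (Real.sin α : ℍ[ℝ])) *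
    ((Real.cos ε : ℍ[ℝ]) - jTheta θ * (Real.sin ε : ℍ[ℝ])) *
    ((Real.cos α : ℍ[ℝ]) + qi * (Real.sin α : ℍ[ℝ]))

@[simp] theorem qi_re : qi.re = 0 := rfl
@[simp] theorem qi_imI : qi.imI = 1 := rfl
@[simp] theorem qi_imJ : qi.imJ = 0 := rfl
@[simp] theorem qi_imK : qi.imK = 0 := rfl
@[simp] theorem qj_re : qj.re = 0 := rfl
@[simp] theorem qj_imI : qj.imI = 0 := rfl
@[simp] theorem qj_imJ : qj.imJ = 1 := rfl
@[simp] theorem qj_imK : qj.imK = 0 := rfl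
@[simp] theorem qk_re : qk.re = 0 := rfl
@[simp] theorem qk_imI : qk.imI = 0 := rfl
@[simp] theorem qk_imJ : qk.imJ = 0 := rfl
@[simp] theorem qk_imK : qk.imK = 1 := rfl

theorem qPrime_aux (ε α θ : ℝ) : qPrime ε α θ =
    ⟨Real.cos ε ^ 2 + Real.sin ε ^ 2 * (Real.cos α ^ 2 - Real.sin α ^ 2),
     Real.sin ε ^ 2 * (2 * Real.sin α * Real.cos α),
     2 * Real.cos ε * Real.sin ε * Real.sin α *
      (Real.sin α * Real.cos θ - Real.cos α * Real.sin θ),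
     2 * Real.cos ε * Real.sin ε * Real.sin α *
      (Real.sin α * Real.sin θ + Real.cos α * Real.cos θ)⟩ := by
  have h1 := Real.sin_sq_add_cos_sq α
  have h2 := Real.sin_sq_add_cos_sq θ
  unfold qPrime jTheta
  generalize Real.cos α = a at *
  generalize Real.sin α = b at *
  generalize Real.cos θ = t at *
  generalize Real.sin θ = u at *
  generalize Real.cos ε = c at *
  generalize Real.sin ε = s at *
  ext <;> simp <;> grind

/-- with `β = (π/2 − α)/2`, the conjugated quaternion
`q'' = e^{−iβ} q' e^{iβ}` equals
`(cos²ε + sin²ε cos 2α) + (sin²ε sin 2α) i + (2 cos ε sin ε sin α)(j cos θ + k sin θ)`. -/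
theorem q_double_prime_identity (ε α θ : ℝ) :
    ((Real.cos ((Real.pi / 2 - α) / 2) : ℍ[ℝ]) -
          qi * (Real.sin ((Real.pi / 2 - α) / 2) : ℍ[ℝ])) *
        qPrime ε α θ *
        ((Real.cos ((Real.pi / 2 - α) / 2) : ℍ[ℝ]) +
          qi * (Real.sin ((Real.pi / 2 - α) / 2) : ℍ[ℝ])) =
      ((Real.cos ε ^ 2 + Real.sin ε ^ 2 * Real.cos (2 * α) : ℝ) : ℍ[ℝ]) +
        ((Real.sin ε ^ 2 * Real.sin (2 * α) : ℝ) : ℍ[ℝ]) * qi +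
        ((2 * Real.cos ε * Real.sin ε * Real.sin α : ℝ) : ℍ[ℝ]) *
          (qj * (Real.cos θ : ℍ[ℝ]) + qk * (Real.sin θ : ℍ[ℝ])) := by
  have h1 := Real.sin_sq_add_cos_sq ((Real.pi / 2 - α) / 2)
  have hs : Real.sin α = Real.cos ((Real.pi / 2 - α) / 2) ^ 2
      - Real.sin ((Real.pi / 2 - α) / 2) ^ 2 := by
    rw [← Real.cos_two_mul', ← Real.cos_pi_div_two_sub]; congr 1; ring
  have hc : Real.cos α = 2 * Real.sin ((Real.pi / 2 - α) / 2)
      * Real.cos ((Real.pi / 2 - α) / 2) := by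
    rw [← Real.sin_two_mul, ← Real.sin_pi_div_two_sub]; congr 1; ring
  have h3 := Real.sin_sq_add_cos_sq α
  have hq := qPrime_aux ε α θ
  have e1 := congrArg QuaternionAlgebra.re hq
  have e2 := congrArg QuaternionAlgebra.imI hq
  have e3 := congrArg QuaternionAlgebra.imJ hq
  have e4 := congrArg QuaternionAlgebra.imK hq
  clear hq
  dsimp only at e1 e2 e3 e4
  rw [Real.cos_two_mul', Real.sin_two_mul]
  generalize qPrime ε α θ = q at *
  generalize Real.cos ((Real.pi / 2 - α) / 2) = C at *
  generalize Real.sin ((Real.pi / 2 - α) / 2) = S at *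
  generalize Real.cos α = a at *
  generalize Real.sin α = b at *
  generalize Real.cos θ = t at *
  generalize Real.sin θ = u at *
  generalize Real.cos ε = c at *
  generalize Real.sin ε = s at *
  generalize hx : c ^ 2 + s ^ 2 * (a ^ 2 - b ^ 2) = x at *
  generalize hy : s ^ 2 * (2 * b * a) = y at *
  generalize hz : 2 * c * s * b = z at *
  clear hx hy hz
  ext <;> simp [e1, e2, e3, e4] <;> grind
end
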